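/- For all m, n ∈ ℤ≥0 and Z ∈ {X,Y}, one has [m+n+1]_{σ^{n+1}(Z)}·[m+n+1]_Z − [m]_Z·[m]_{σ^{n+1}(Z)} = [n+1]_Z·[2m+n+1]_{σ^{m}(Z)} in ℤ[X,Y]. -/

import Mathlib

/-- The polynomial ring `ℤ[X,Y]`, with the variable `X` indexed by `true` and
the variable `Y` indexed by `false`. -/
noncomputable abbrev TCQ.R₀ : Type := MvPolynomial Bool ℤ

/-- The two-colored quantum numbers `[n]_X, [n]_Y ∈ ℤ[X,Y]`.  The color `Z ∈ {X,Y}` is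
encoded as a `Bool` (`true` for `X`, `false` for `Y`), and `σ(Z)` is `!Z`.
They are defined by `[0]_Z = 0`, `[1]_Z = 1` and `[n+1]_Z = Z·[n]_{σ(Z)} − [n−1]_Z`. -/
noncomputable def TCQ.q : Bool → ℕ → TCQ.R₀
  | _, 0 => 0
  | _, 1 => 1
  | c, (n + 2) => MvPolynomial.X c * TCQ.q (!c) (n + 1) - TCQ.q c n

namespace TCQ

theorem q_add_two (c : Bool) (n : ℕ) :
    q c (n + 2) = MvPolynomial.X c * q (!c) (n + 1) - q c n := by
  rw [q]

theorem not_iterate_not (n : ℕ) (c : Bool) : Bool.not^[n] (!c) = !(Bool.not^[n] c) := by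
  rw [← Function.iterate_succ_apply, Function.iterate_succ_apply']

theorem not_iterate_two_mul (n : ℕ) (c : Bool) : Bool.not^[2 * n] c = c := by
  rw [Function.iterate_mul]
  exact Function.iterate_fixed (Bool.not_not c) n

/-- The addition formula
`[a+b+1]_c = [a+1]_c·[b+1]_{σ^a(c)} − [a]_c·[b]_{σ^{a+1}(c)}`. -/
theorem q_add_add_one (b : ℕ) : ∀ (a : ℕ) (c : Bool),
    q c (a + b + 1) = q c (a + 1) * q (Bool.not^[a] c) (b + 1)
      - q c a * q (!(Bool.not^[a] c)) b
  | 0, c => by simp [q]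
  | 1, c => by
    rw [show 1 + b + 1 = b + 2 by ring, q_add_two, q_add_two]
    simp [q]
  | a + 2, c => by
    have h₁ := q_add_add_one b (a + 1) (!c)
    have h₂ := q_add_add_one b a c
    rw [show a + 1 + b + 1 = a + b + 1 + 1 by ring] at h₁
    rw [show a + 2 + b + 1 = a + b + 1 + 2 by ring, q_add_two, h₁, h₂,
      show a + 2 + 1 = a + 1 + 2 by ring, q_add_two c (a + 1), q_add_two c a]
    simp only [Function.iterate_succ_apply, Bool.not_not]
    ring

theorem q_not_iterate_self : ∀ (n : ℕ) (c : Bool), q (Bool.not^[n] c) n = q c n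
  | 0, _ => rfl
  | 1, _ => by simp [q]
  | n + 2, c => by
    have h₁ := q_not_iterate_self (n + 1) c
    have h₂ := q_not_iterate_self n c
    have h := q_add_add_one 1 n c
    simp only [Function.iterate_succ_apply, not_iterate_not, Bool.not_not] at h₁ ⊢
    rw [q_add_two, h₁, h₂, show n + 2 = n + 1 + 1 by ring, h, q_add_two]
    simp [q]
    ring

/-- Cassini's identity for two-colored quantum numbers. -/
theorem q_mul_q_add_two_add_one (n : ℕ) (c : Bool) :
    q c n * q (!c) (n + 2) + 1 = q c (n + 1) * q (!c) (n + 1) := by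
  induction n generalizing c with
  | zero => simp [q]
  | succ n ih =>
    have h := ih (!c)
    have h₁ := q_add_two (!c) (n + 1)
    have h₂ := q_add_two (!c) n
    simp only [Bool.not_not] at h h₁ h₂
    rw [show n + 1 + 2 = n + 3 by ring, show n + 1 + 1 = n + 2 by ring] at *
    linear_combination q c (n + 1) * h₁ - q c (n + 2) * h₂ + h

/-- D'Ocagne's identity for two-colored quantum numbers. -/
theorem q_mul_q_add_add_one_add (n : ℕ) (c : Bool) : ∀ m : ℕ,
    q c n * q (Bool.not^[m] c) (m + n + 1) + q (Bool.not^[m] c) m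
      = q c (n + 1) * q (Bool.not^[m] c) (m + n)
  | 0 => by simp [q, mul_comm]
  | 1 => by
    have h := q_mul_q_add_two_add_one n c
    rw [show 1 + n + 1 = n + 2 by ring, add_comm 1 n]
    simpa [q] using h
  | m + 2 => by
    have h₁ := q_mul_q_add_add_one_add n c (m + 1)
    have h₂ := q_mul_q_add_add_one_add n c m
    simp only [Function.iterate_succ_apply, not_iterate_not, Bool.not_not] at h₁ ⊢
    rw [show m + 1 + n + 1 = m + n + 1 + 1 by ring, show m + 1 + n = m + n + 1 by ring] at h₁
    rw [show m + 2 + n + 1 = m + n + 1 + 2 by ring, show m + 2 + n = m + n + 2 by ring,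
      q_add_two (Bool.not^[m] c) (m + n + 1), q_add_two (Bool.not^[m] c) (m + n),
      q_add_two _ m]
    linear_combination MvPolynomial.X (Bool.not^[m] c) * h₁ - h₂

end TCQ

open TCQ in
/-- `[m+n+1]_{σ^{n+1}(Z)}·[m+n+1]_Z − [m]_Z·[m]_{σ^{n+1}(Z)}
  = [n+1]_Z·[2m+n+1]_{σ^{m}(Z)}`. -/
theorem tcq_product_difference' (m n : ℕ) (Z : Bool) :
    q (Bool.not^[n + 1] Z) (m + n + 1) * q Z (m + n + 1) - q Z m * q (Bool.not^[n + 1] Z) m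
      = q Z (n + 1) * q (Bool.not^[m] Z) (2 * m + n + 1) := by
  have hN : q (Bool.not^[n + 1] Z) (m + n + 1) = q (Bool.not^[m] Z) (m + n + 1) := by
    rw [← q_not_iterate_self (m + n + 1) (Bool.not^[n + 1] Z), ← Function.iterate_add_apply,
      show m + n + 1 + (n + 1) = m + 2 * (n + 1) by ring, Function.iterate_add_apply,
      not_iterate_two_mul]
  have hZ := q_add_add_one m n Z
  have hR := q_add_add_one m (m + n) (Bool.not^[m] Z)
  have hD := q_mul_q_add_add_one_add n Z m
  have hc : Bool.not^[m + n] (Bool.not^[m] Z) = Bool.not^[n] Z := by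
    rw [← Function.iterate_add_apply, show m + n + m = n + 2 * m by ring,
      Function.iterate_add_apply, not_iterate_two_mul]
  rw [hc, show m + n + m + 1 = 2 * m + n + 1 by ring] at hR
  rw [q_not_iterate_self m Z] at hD
  rw [add_comm n m] at hZ
  rw [hN, hR, Function.iterate_succ_apply']
  linear_combination q (Bool.not^[m] Z) (m + n + 1) * hZ - q (!(Bool.not^[n] Z)) m * hD
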